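/- arXiv:1710.00328 — 5 statements merged into one kernel-verified Lean document; each statement's English description precedes it below -/
import Mathlib

section
/- Let $A \in \mathbb{Z}^{(n+1) \times n}$, $b \in \mathbb{Z}^{n+1}$, and suppose $P = P(A,b) = \{x \in \mathbb{R}^n : Ax \le b\}$ is an $n$-dimensional simplex. If the lattice width of $P$ satisfies $w(P) > \delta(A)$, where $\delta(A)$ is the smallest absolute value of the determinants of the $n \times n$ submatrices of $A$, then $P$ contains an integer point, i.e. $P \cap \mathbb{Z}^n \ne \emptyset$. -/
open scoped BigOperators


/-- In a finite additive group, every sum of generators can be shortened to fewer than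
`Nat.card G` summands. -/
theorem exists_list_sum_eq_of_length_lt_card {G : Type*} [AddGroup G] [Finite G] (s : Set G)
    (g : G) (hg : g ∈ AddSubmonoid.closure s) :
    ∃ l : List G, (∀ a ∈ l, a ∈ s) ∧ l.sum = g ∧ l.length < Nat.card G := by
  classical
  have hex : ∃ m, ∃ l : List G, (∀ a ∈ l, a ∈ s) ∧ l.sum = g ∧ l.length = m := by
    obtain ⟨l, h₁, h₂⟩ := AddSubmonoid.exists_list_of_mem_closure hg
    exact ⟨_, l, h₁, h₂, rfl⟩
  obtain ⟨l, hs, hsum, hlen⟩ := Nat.find_spec hex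
  refine ⟨l, hs, hsum, ?_⟩
  by_contra! hcard
  have : Fintype G := Fintype.ofFinite G
  have hninj : ¬ Function.Injective (fun i : Fin (l.length + 1) => (l.take i).sum) := by
    intro hinj
    have := Fintype.card_le_of_injective _ hinj
    rw [Fintype.card_fin, ← Nat.card_eq_fintype_card] at this
    omega
  have key : ∀ i j : Fin (l.length + 1), i < j → (l.take i).sum ≠ (l.take j).sum := by
    intro i j hij heq
    refine Nat.find_min hex (m := (l.take i ++ l.drop j).length) ?_
      ⟨l.take i ++ l.drop j, ?_, ?_, rfl⟩
    · rw [← hlen]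
      simp only [List.length_append, List.length_take, List.length_drop]
      have := j.isLt
      have : (i : ℕ) < j := hij
      omega
    · intro a ha
      rcases List.mem_append.1 ha with h | h
      · exact hs a (List.mem_of_mem_take h)
      · exact hs a (List.mem_of_mem_drop h)
    · rw [List.sum_append, heq, ← List.sum_append, List.take_append_drop, hsum]
  refine hninj fun i j h => ?_
  rcases lt_trichotomy i j with hij | hij | hij
  · exact absurd h (key i j hij)
  · exact hij
  · exact absurd h.symm (key j i hij)

theorem List.exists_sum_eq_sum_nsmul {ι G : Type*} [Fintype ι] [AddCommMonoid G] (v : ι → G)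
    (l : List G) (hl : ∀ a ∈ l, a ∈ Set.range v) :
    ∃ y : ι → ℕ, ∑ i, y i = l.length ∧ ∑ i, y i • v i = l.sum := by
  classical
  induction l with
  | nil => exact ⟨0, by simp, by simp⟩
  | cons a l ih =>
    obtain ⟨y, h₁, h₂⟩ := ih fun x hx => hl x (List.mem_cons_of_mem _ hx)
    obtain ⟨i, hi⟩ := hl a List.mem_cons_self
    refine ⟨y + Pi.single i 1, ?_, ?_⟩
    · simp [Finset.sum_add_distrib, h₁]
    · simp [add_smul, Finset.sum_add_distrib, h₂, Pi.single_apply, ite_smul, hi, add_comm]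

theorem Matrix.natCard_quotient_range_mulVecLin {ι : Type*} [Fintype ι] [DecidableEq ι]
    (M : Matrix ι ι ℤ) (hM : M.det ≠ 0) :
    Nat.card ((ι → ℤ) ⧸ LinearMap.range M.mulVecLin) = M.det.natAbs := by
  have hinj : Function.Injective M.mulVecLin := by
    rw [← LinearMap.ker_eq_bot, LinearMap.ker_eq_bot']
    exact fun z hz => Matrix.eq_zero_of_mulVec_eq_zero hM hz
  have h := Submodule.natAbs_det_equiv (LinearMap.range M.mulVecLin)
    (LinearEquiv.ofInjective M.mulVecLin hinj)
  have hcomp : (LinearMap.range M.mulVecLin).subtype ∘ₗ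
      ((LinearEquiv.ofInjective M.mulVecLin hinj : (ι → ℤ) ≃ₗ[ℤ] _) : (ι → ℤ) →ₗ[ℤ] _) =
      Matrix.toLin' M := by
    ext; rfl
  rw [← LinearMap.det_toLin', ← hcomp]
  exact h.symm

/-- Modulo the lattice spanned by the columns of `M`, every integer vector is congruent to a
nonnegative one with coordinate sum less than `|det M|`. -/
theorem Matrix.exists_mulVec_add_natCast_eq {ι : Type*} [Fintype ι] [DecidableEq ι]
    (M : Matrix ι ι ℤ) (hM : M.det ≠ 0) (b : ι → ℤ) :
    ∃ (x : ι → ℤ) (y : ι → ℕ), (∀ i, (M.mulVec x) i + y i = b i) ∧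
      ∑ i, y i < M.det.natAbs := by
  have hcard := M.natCard_quotient_range_mulVecLin hM
  set N := LinearMap.range M.mulVecLin
  have hfin : Finite ((ι → ℤ) ⧸ N) :=
    Nat.finite_of_card_ne_zero (by rw [hcard]; exact Int.natAbs_ne_zero.2 hM)
  let v : ι → (ι → ℤ) ⧸ N := fun i => N.mkQ (Pi.single i 1)
  have hv : ∀ z : ι → ℤ, N.mkQ z = ∑ i, z i • v i := by
    intro z
    conv_lhs => rw [pi_eq_sum_univ' z]
    simp only [map_sum, map_smul, v]
  have hmem : N.mkQ b ∈ AddSubmonoid.closure (Set.range v) := by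
    rw [hv]
    refine sum_mem fun i _ => ?_
    rw [← mod_natCard_zsmul (v i) (b i)]
    have hpos : (0 : ℤ) < Nat.card ((ι → ℤ) ⧸ N) := by exact_mod_cast Nat.card_pos
    obtain ⟨m, hm⟩ := Int.eq_ofNat_of_zero_le (Int.emod_nonneg (b i) hpos.ne')
    rw [hm, natCast_zsmul]
    exact nsmul_mem (AddSubmonoid.subset_closure (Set.mem_range_self i)) m
  obtain ⟨l, hl, hsum, hlen⟩ := exists_list_sum_eq_of_length_lt_card _ _ hmem
  obtain ⟨y, hy, hyv⟩ := List.exists_sum_eq_sum_nsmul v l hl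
  have hq : N.mkQ b = N.mkQ (fun i => (y i : ℤ)) := by
    rw [hv (fun i => (y i : ℤ)), ← hsum, ← hyv]
    simp
  have hq' : b - (fun i => (y i : ℤ)) ∈ N := by
    rw [← Submodule.ker_mkQ N, LinearMap.mem_ker, map_sub, hq, sub_self]
  obtain ⟨x, hx⟩ := hq'
  refine ⟨x, y, fun i => ?_, by rw [hy, ← hcard]; exact hlen⟩
  have := congrFun hx i
  simp only [Matrix.mulVecLin_apply, Pi.sub_apply] at this
  omega

theorem Bornology.IsBounded.exists_mulVec_pos {m n : Type*} [Fintype n]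
    {A : Matrix m n ℝ} {b : m → ℝ} (hb : Bornology.IsBounded {x | ∀ i, A.mulVec x i ≤ b i})
    {x : n → ℝ} (hx : ∀ i, A.mulVec x i ≤ b i) {d : n → ℝ} (hd : d ≠ 0) :
    ∃ i, 0 < A.mulVec d i := by
  by_contra! hcon
  obtain ⟨R, hR⟩ := hb.exists_norm_le
  have hd' : 0 < ‖d‖ := norm_pos_iff.2 hd
  have hR0 : 0 ≤ R := (norm_nonneg x).trans (hR x hx)
  set t := (R + ‖x‖ + 1) / ‖d‖ with ht
  have ht0 : 0 ≤ t := by positivity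
  have h1 : ‖x + t • d‖ ≤ R := by
    refine hR _ fun i => ?_
    rw [Matrix.mulVec_add, Matrix.mulVec_smul, Pi.add_apply, Pi.smul_apply, smul_eq_mul]
    nlinarith [hx i, mul_nonneg ht0 (neg_nonneg.2 (hcon i))]
  have h2 : ‖t • d‖ = R + ‖x‖ + 1 := by
    rw [norm_smul, Real.norm_of_nonneg ht0, ht, div_mul_cancel₀ _ hd'.ne']
  have h3 : ‖t • d‖ ≤ ‖x + t • d‖ + ‖x‖ := by
    simpa using norm_sub_le (x + t • d) x
  linarith

/-- The smallest absolute value of the determinants of the `n × n` submatrices of an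
`(n+1) × n` integer matrix. -/
noncomputable def minSubdet (n : ℕ) (A : Matrix (Fin (n + 1)) (Fin n) ℤ) : ℕ :=
  sInf {d : ℕ | ∃ f : Fin n → Fin (n + 1), StrictMono f ∧
    d = (A.submatrix f id).det.natAbs}

/-- If an `n`-dimensional simplex `P = P(A,b)` has lattice width greater than `δ(A)`,
then it contains an integer point. -/
theorem simplex_width_gt_delta_implies_integer_point
    (n : ℕ) (A : Matrix (Fin (n + 1)) (Fin n) ℤ) (b : Fin (n + 1) → ℤ)
    (P : Set (Fin n → ℝ))
    (hP : P = {x : Fin n → ℝ | ∀ i, (∑ j, (A i j : ℝ) * x j) ≤ (b i : ℝ)})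
    (hsimplex : ∃ w : Fin (n + 1) → (Fin n → ℝ),
      AffineIndependent ℝ w ∧ P = convexHull ℝ (Set.range w))
    (hwidth : ∀ c : Fin n → ℤ, c ≠ 0 →
      sSup ((fun x : Fin n → ℝ => ∑ i, (c i : ℝ) * x i) '' P)
          - sInf ((fun x : Fin n → ℝ => ∑ i, (c i : ℝ) * x i) '' P)
        > (minSubdet n A : ℝ)) :
    ∃ x : Fin n → ℤ, (fun i => (x i : ℝ)) ∈ P := by
  classical
  obtain ⟨w, -, hw⟩ := hsimplex
  have hbdd : Bornology.IsBounded P := by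
    rw [hw]; exact (isBounded_convexHull).2 (Set.finite_range w).isBounded
  have hne : P.Nonempty := ⟨w 0, by rw [hw]; exact subset_convexHull ℝ _ ⟨0, rfl⟩⟩
  obtain ⟨p, hp⟩ := hne
  set B : Matrix (Fin (n + 1)) (Fin n) ℝ := A.map (Int.cast : ℤ → ℝ) with hB
  have hmem : ∀ x : Fin n → ℝ, x ∈ P ↔ ∀ i, B.mulVec x i ≤ (b i : ℝ) := by
    intro x; rw [hP]; rfl
  have hPB : P = {x | ∀ i, B.mulVec x i ≤ (b i : ℝ)} := Set.ext hmem
  have hray : ∀ d : Fin n → ℝ, d ≠ 0 → ∃ i, 0 < B.mulVec d i := fun d hd =>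
    (hPB ▸ hbdd : Bornology.IsBounded {x | ∀ i, B.mulVec x i ≤ (b i : ℝ)}).exists_mulVec_pos
      ((hmem p).1 hp) hd
  obtain ⟨f, hf, hδ⟩ : minSubdet n A ∈ {d : ℕ | ∃ f : Fin n → Fin (n + 1), StrictMono f ∧
      d = (A.submatrix f id).det.natAbs} :=
    Nat.sInf_mem ⟨_, Fin.castSucc, Fin.strictMono_castSucc, rfl⟩
  obtain ⟨k, hk⟩ : ∃ k, ∀ i, i = k ∨ ∃ j, f j = i := by
    have hcard : (Finset.univ.image f)ᶜ.card = 1 := by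
      rw [Finset.card_compl, Finset.card_image_of_injective _ hf.injective]; simp
    obtain ⟨k, hk⟩ := Finset.card_eq_one.1 hcard
    refine ⟨k, fun i => or_iff_not_imp_right.2 fun hi => ?_⟩
    have : i ∈ (Finset.univ.image f)ᶜ := by simpa using hi
    rwa [hk, Finset.mem_singleton] at this
  set M := A.submatrix f id with hM
  set C : Matrix (Fin n) (Fin n) ℝ := M.map (Int.cast : ℤ → ℝ) with hC
  have hCB : ∀ (x : Fin n → ℝ) j, C.mulVec x j = B.mulVec x (f j) := fun _ _ => rfl
  have hpos : ∀ d : Fin n → ℝ, d ≠ 0 → (∀ j, C.mulVec d j ≤ 0) → 0 < B.mulVec d k := by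
    intro d hd hCd
    obtain ⟨i, hi⟩ := hray d hd
    rcases hk i with rfl | ⟨j, rfl⟩
    · exact hi
    · exact absurd hi (hCd j).not_gt
  have hdetC : C.det ≠ 0 := by
    intro h0
    obtain ⟨d, hd, hd0⟩ := Matrix.exists_mulVec_eq_zero_iff.2 h0
    have h1 := hpos d hd (by simp [hd0])
    have h2 := hpos (-d) (neg_ne_zero.2 hd) (by simp [Matrix.mulVec_neg, hd0])
    rw [Matrix.mulVec_neg, Pi.neg_apply] at h2
    linarith
  have hdetM : M.det ≠ 0 := by
    intro h0
    apply hdetC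
    have := (Int.castRingHom ℝ).map_det M
    rw [h0, map_zero] at this
    exact this.symm
  have hunit : IsUnit C.det := isUnit_iff_ne_zero.2 hdetC
  let c : Fin n → ℝ := fun j => - B.mulVec (C⁻¹.mulVec (Pi.single j 1)) k
  have hc : ∀ j, 0 < c j := by
    intro j
    have hCd : C.mulVec (C⁻¹.mulVec (Pi.single j 1)) = Pi.single j 1 := by
      rw [Matrix.mulVec_mulVec, Matrix.mul_nonsing_inv _ hunit, Matrix.one_mulVec]
    have := hpos (-C⁻¹.mulVec (Pi.single j 1)) ?_ ?_
    · rwa [Matrix.mulVec_neg] at this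
    · intro h0
      rw [neg_eq_zero.1 h0, Matrix.mulVec_zero] at hCd
      simpa using congrFun hCd j
    · intro i
      rw [Matrix.mulVec_neg, hCd, Pi.neg_apply, Left.neg_nonpos_iff]
      exact (Pi.single_nonneg.2 zero_le_one : (0 : Fin n → ℝ) ≤ Pi.single j 1) i
  let b' : Fin n → ℝ := fun j => b (f j)
  have hrow : ∀ x : Fin n → ℝ, B.mulVec x k =
      B.mulVec (C⁻¹.mulVec b') k + ∑ j, c j * (b' j - C.mulVec x j) := by
    intro x
    have hx : x = C⁻¹.mulVec b' - C⁻¹.mulVec (b' - C.mulVec x) := by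
      rw [← Matrix.mulVec_sub, sub_sub_cancel, Matrix.mulVec_mulVec,
        Matrix.nonsing_inv_mul _ hunit, Matrix.one_mulVec]
    have hlin : ∀ z : Fin n → ℝ, B.mulVec (C⁻¹.mulVec z) k = - ∑ j, c j * z j := by
      intro z
      simp only [c, Matrix.mulVec_mulVec, neg_mul, Finset.sum_neg_distrib, neg_neg,
        Matrix.mulVec_single_one]
      rfl
    conv_lhs => rw [hx]
    rw [Matrix.mulVec_sub, Pi.sub_apply, hlin (b' - C.mulVec x), sub_neg_eq_add]
    rfl
  set γ : ℝ := b k - B.mulVec (C⁻¹.mulVec b') k with hγ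
  have hmem' : ∀ x : Fin n → ℝ, x ∈ P ↔
      (∀ j, C.mulVec x j ≤ b' j) ∧ ∑ j, c j * (b' j - C.mulVec x j) ≤ γ := by
    intro x
    rw [hmem]
    constructor
    · intro h
      refine ⟨fun j => h (f j), ?_⟩
      have := h k
      rw [hrow] at this
      linarith
    · rintro ⟨h1, h2⟩ i
      rcases hk i with rfl | ⟨j, rfl⟩
      · rw [hrow]; linarith
      · exact h1 j
  have hslack : ∀ x ∈ P, ∀ j, c j * (b' j - C.mulVec x j) ≤ γ := by
    intro x hx j
    obtain ⟨h1, h2⟩ := (hmem' x).1 hx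
    refine le_trans ?_ h2
    exact Finset.single_le_sum (f := fun j => c j * (b' j - C.mulVec x j))
      (fun i _ => mul_nonneg (hc i).le (sub_nonneg.2 (h1 i))) (Finset.mem_univ j)
  have hγ0 : 0 ≤ γ := by
    obtain ⟨h1, h2⟩ := (hmem' p).1 hp
    exact (Finset.sum_nonneg fun i _ => mul_nonneg (hc i).le (sub_nonneg.2 (h1 i))).trans h2
  have hδc : ∀ j, (M.det.natAbs : ℝ) * c j ≤ γ := by
    intro j
    have hMj : M j ≠ 0 := fun h0 => hdetM (Matrix.det_eq_zero_of_row_eq_zero j (congrFun h0))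
    have h := hwidth (M j) hMj
    have himg : (fun x : Fin n → ℝ => ∑ i, (M j i : ℝ) * x i) = fun x => C.mulVec x j := rfl
    rw [himg, hδ] at h
    have hne : ((fun x => C.mulVec x j) '' P).Nonempty := ⟨_, p, hp, rfl⟩
    have hsup : sSup ((fun x => C.mulVec x j) '' P) ≤ b' j := by
      refine csSup_le hne ?_
      rintro _ ⟨x, hx, rfl⟩
      exact ((hmem' x).1 hx).1 j
    have hinf : b' j - γ / c j ≤ sInf ((fun x => C.mulVec x j) '' P) := by
      refine le_csInf hne ?_
      rintro _ ⟨x, hx, rfl⟩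
      have : b' j - C.mulVec x j ≤ γ / c j := by
        rw [le_div_iff₀ (hc j), mul_comm]; exact hslack x hx j
      simp only
      linarith
    rw [← le_div_iff₀ (hc j)]
    linarith
  obtain ⟨x, y, hxy, hy⟩ := M.exists_mulVec_add_natCast_eq hdetM fun j => b (f j)
  have hCx : ∀ j, b' j - C.mulVec (fun i => (x i : ℝ)) j = y j := by
    intro j
    have h1 : C.mulVec (fun i => (x i : ℝ)) j = ((M.mulVec x j : ℤ) : ℝ) := by
      simp [Matrix.mulVec, dotProduct, hC]
    have h2 : ((M.mulVec x j : ℤ) : ℝ) + y j = b (f j) := by exact_mod_cast hxy j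
    simp only [b']
    linarith
  refine ⟨x, (hmem' _).2 ⟨fun j => ?_, ?_⟩⟩
  · have := hCx j
    have : (0 : ℝ) ≤ y j := Nat.cast_nonneg _
    linarith
  · simp only [hCx]
    have hD : (0 : ℝ) < M.det.natAbs := by exact_mod_cast Int.natAbs_pos.2 hdetM
    have hy' : ∑ j, (y j : ℝ) ≤ M.det.natAbs := by exact_mod_cast hy.le
    refine le_of_mul_le_mul_left ?_ hD
    calc (M.det.natAbs : ℝ) * ∑ j, c j * y j = ∑ j, (M.det.natAbs * c j) * (y j : ℝ) := by
          rw [Finset.mul_sum]; simp only [mul_assoc]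
      _ ≤ ∑ j, γ * (y j : ℝ) :=
          Finset.sum_le_sum fun j _ => mul_le_mul_of_nonneg_right (hδc j) (Nat.cast_nonneg _)
      _ = γ * ∑ j, (y j : ℝ) := by rw [Finset.mul_sum]
      _ ≤ γ * M.det.natAbs := mul_le_mul_of_nonneg_left hy' hγ0
      _ = M.det.natAbs * γ := mul_comm _ _
end

section
/- Let $A \in \mathbb{Z}^{n \times n}$ with $|\det(A)| = \Delta > 0$. Then there exist $s$ unimodular integer matrices $B^{(1)}, \dots, B^{(s)} \in \mathbb{Z}^{n \times n}$ with $s \le n^{2 \log_2 \Delta}$ such that $\mathrm{cone}(A) = \bigcup_{j=1}^{s} \mathrm{cone}(B^{(j)})$. -/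
/-- The cone spanned by the columns of a matrix. -/
def coneOf {m n : ℕ} (A : Matrix (Fin m) (Fin n) ℝ) : Set (Fin m → ℝ) :=
  {x | ∃ t : Fin n → ℝ, (∀ j, 0 ≤ t j) ∧ x = A.mulVec t}

open Finset in
theorem sum_log_div_le (M : ℕ) : ∑ b ∈ Icc 1 M, Nat.log 2 (M / b) ≤ M := by
  induction M using Nat.strong_induction_on with
  | _ M ih =>
    rcases Nat.lt_or_ge M 1 with h0 | h0
    · simp [show M = 0 by omega]
    have hsub : Icc 1 (M / 2) ⊆ Icc 1 M := Icc_subset_Icc_right (Nat.div_le_self M 2)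
    rw [← sum_subset hsub]
    · have hterm : ∀ b ∈ Icc 1 (M / 2), Nat.log 2 (M / b) = Nat.log 2 (M / 2 / b) + 1 := by
        intro b hb
        rw [mem_Icc] at hb
        have h2 : 2 ≤ M / b := by
          rw [Nat.le_div_iff_mul_le (by omega)]
          omega
        rw [Nat.log_of_one_lt_of_le (by norm_num) h2, Nat.div_div_eq_div_mul,
          Nat.div_div_eq_div_mul, Nat.mul_comm]
      rw [sum_congr rfl hterm, sum_add_distrib]
      have := ih (M / 2) (by omega)
      simp
      omega
    · intro b hb hb'
      rw [mem_Icc] at hb hb'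
      have : M / b < 2 := by
        rw [Nat.div_lt_iff_lt_mul (by omega)]
        omega
      exact Nat.log_of_lt this

open Finset in
theorem ZMod.sum_val_eq_sum_range (p : ℕ) [NeZero p] (f : ℕ → ℕ) :
    ∑ a : ZMod p, f a.val = ∑ b ∈ range p, f b := by
  refine sum_nbij' ZMod.val (fun b => (b : ZMod p)) ?_ ?_ ?_ ?_ ?_
  · simp [ZMod.val_lt]
  · simp
  · simp
  · intro b hb
    exact ZMod.val_cast_of_lt (mem_range.1 hb)
  · simp

/-- The number of times `a : ZMod p` can be doubled while its representative in `[0, p)` stays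
above `p / 2`. -/
def doublingLevel (p : ℕ) (a : ZMod p) : ℕ := Nat.log 2 ((p - 1) / (-a).val)

theorem doublingLevel_zero (p : ℕ) : doublingLevel p 0 = 0 := by
  simp [doublingLevel]

open Finset in
theorem sum_doublingLevel_le (p : ℕ) [NeZero p] : ∑ a : ZMod p, doublingLevel p a ≤ p - 1 := by
  have hp : 0 < p := Nat.pos_of_ne_zero (NeZero.ne p)
  calc ∑ a : ZMod p, doublingLevel p a
      = ∑ a : ZMod p, Nat.log 2 ((p - 1) / a.val) :=
        Fintype.sum_equiv (Equiv.neg _) _ _ fun a => by simp [doublingLevel]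
    _ = ∑ b ∈ range p, Nat.log 2 ((p - 1) / b) :=
        ZMod.sum_val_eq_sum_range p fun b => Nat.log 2 ((p - 1) / b)
    _ = ∑ b ∈ Icc 1 (p - 1), Nat.log 2 ((p - 1) / b) := by
        symm
        apply sum_subset
        · intro b hb
          rw [mem_Icc] at hb
          rw [mem_range]
          omega
        · intro b hb hb'
          rw [mem_range] at hb
          rw [mem_Icc] at hb'
          simp [show b = 0 by omega]
    _ ≤ p - 1 := sum_log_div_le _

open Finset in
theorem exists_mul_sum_doublingLevel_le (p : ℕ) [Fact p.Prime] {n : ℕ} (v : Fin n → ZMod p) :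
    ∃ m : ZMod p, m ≠ 0 ∧ ∑ h, doublingLevel p (m * v h) ≤ n := by
  have hp := (Fact.out : p.Prime).two_le
  have hcard : (univ.erase (0 : ZMod p)).card = p - 1 := by
    rw [card_erase_of_mem (mem_univ _), card_univ, ZMod.card]
  have hsum : ∑ m ∈ univ.erase (0 : ZMod p), ∑ h, doublingLevel p (m * v h)
      ≤ ∑ _m ∈ univ.erase (0 : ZMod p), n := by
    rw [sum_comm, sum_const, hcard, smul_eq_mul]
    calc ∑ h, ∑ m ∈ univ.erase (0 : ZMod p), doublingLevel p (m * v h)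
        ≤ ∑ _h : Fin n, (p - 1) := by
          refine sum_le_sum fun h _ => ?_
          by_cases hv : v h = 0
          · simp [hv, doublingLevel_zero]
          · calc _ ≤ ∑ m : ZMod p, doublingLevel p (m * v h) :=
                  sum_le_sum_of_subset (erase_subset _ _)
              _ = ∑ a : ZMod p, doublingLevel p a :=
                  Fintype.sum_equiv (Equiv.mulRight₀ (v h) hv) _ _ fun a => by simp
              _ ≤ p - 1 := sum_doublingLevel_le p
      _ = (p - 1) * n := by simp [Nat.mul_comm]
  obtain ⟨m, hm, hle⟩ := exists_le_of_sum_le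
    (card_pos.1 (by rw [hcard]; omega)) hsum
  exact ⟨m, (mem_erase.1 hm).1, hle⟩

theorem lt_doublingLevel_iff {p : ℕ} [Fact p.Prime] {a : ZMod p} (ha : a ≠ 0) (i : ℕ) :
    i < doublingLevel p a ↔ 2 ^ (i + 1) * (-a).val < p := by
  have hp := (Fact.out : p.Prime).two_le
  have hb : 0 < (-a).val := by
    rw [Nat.pos_iff_ne_zero, Ne, ZMod.val_eq_zero, neg_eq_zero]
    exact ha
  have hb' := ZMod.val_lt (-a)
  have hq : (p - 1) / (-a).val ≠ 0 := (Nat.div_pos (by omega) hb).ne'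
  rw [doublingLevel, ← Nat.succ_le_iff, Nat.le_log_iff_pow_le (by norm_num) hq,
    Nat.le_div_iff_mul_le hb]
  simp only [Nat.succ_eq_add_one]
  omega

theorem two_pow_mul_val_neg_lt {p : ℕ} [Fact p.Prime] {a : ZMod p} (ha : a ≠ 0) {i : ℕ}
    (hi : i ≤ doublingLevel p a) : 2 ^ i * (-a).val < p := by
  rcases i with _ | i
  · simpa using ZMod.val_lt (-a)
  · exact (lt_doublingLevel_iff ha i).1 hi

theorem val_two_pow_mul {p : ℕ} [Fact p.Prime] {a : ZMod p} (ha : a ≠ 0) {i : ℕ}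
    (hi : i ≤ doublingLevel p a) : ((2 : ZMod p) ^ i * a).val + 2 ^ i * (-a).val = p := by
  have hlt := two_pow_mul_val_neg_lt ha hi
  have hb : 0 < (-a).val := by
    rw [Nat.pos_iff_ne_zero, Ne, ZMod.val_eq_zero, neg_eq_zero]
    exact ha
  have h1 : (2 : ZMod p) ^ i * a = ((p - 2 ^ i * (-a).val : ℕ) : ZMod p) := by
    rw [Nat.cast_sub hlt.le]
    simp
  have h2 : 0 < 2 ^ i * (-a).val := by positivity
  rw [h1, ZMod.val_cast_of_lt (by omega)]
  omega

/-- The first zero on a family of segments from nonnegative to possibly negative values. -/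
theorem exists_first_zero {ι : Type*} [Fintype ι] (α β : ι → ℝ) (hα : ∀ j, 0 ≤ α j)
    (hβ : ∃ j, β j < 0) :
    ∃ s : ℝ, 0 ≤ s ∧ s ≤ 1 ∧ (∀ j, 0 ≤ (1 - s) * α j + s * β j) ∧
      ∃ l, β l < 0 ∧ (1 - s) * α l + s * β l = 0 := by
  classical
  obtain ⟨j₀, hj₀⟩ := hβ
  obtain ⟨l, hl, hmin⟩ := Finset.exists_min_image (Finset.univ.filter fun j => β j < 0)
    (fun j => α j / (α j - β j)) ⟨j₀, by simpa using hj₀⟩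
  simp only [Finset.mem_filter, Finset.mem_univ, true_and] at hl hmin
  have hd : ∀ j, β j < 0 → 0 < α j - β j := fun j hj => by linarith [hα j]
  have hs0 : 0 ≤ α l / (α l - β l) := div_nonneg (hα l) (hd l hl).le
  have hs1 : α l / (α l - β l) ≤ 1 := by
    rw [div_le_one (hd l hl)]
    linarith
  refine ⟨α l / (α l - β l), hs0, hs1, fun j => ?_, l, hl, ?_⟩
  · rcases lt_or_ge (β j) 0 with hj | hj
    · have := hmin j hj
      rw [le_div_iff₀ (hd j hj)] at this
      linarith
    · have := mul_nonneg (sub_nonneg.2 hs1) (hα j)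
      have := mul_nonneg hs0 hj
      linarith
  · have := (hd l hl).ne'
    field_simp
    ring

theorem coneOf_subset {m n k : ℕ} {A : Matrix (Fin m) (Fin n) ℝ} {B : Matrix (Fin m) (Fin k) ℝ}
    (h : ∀ j, B.col j ∈ coneOf A) : coneOf B ⊆ coneOf A := by
  choose M hM hBM using h
  rintro x ⟨t, ht, rfl⟩
  refine ⟨fun i => ∑ j, t j * M j i, fun i => Finset.sum_nonneg fun j _ =>
    mul_nonneg (ht j) (hM j i), ?_⟩
  have hB : B = A * (Matrix.of M).transpose := by
    ext i j
    exact congrFun (hBM j) i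
  rw [hB, ← Matrix.mulVec_mulVec]
  congr 1
  ext i
  simp [Matrix.mulVec, dotProduct, mul_comm]

theorem col_mem_coneOf {m n : ℕ} (A : Matrix (Fin m) (Fin n) ℝ) (j : Fin n) :
    A.col j ∈ coneOf A := by
  refine ⟨Pi.single j 1, fun i => ?_, by simp⟩
  by_cases h : i = j
  · subst h; simp
  · simp [h]

theorem coneOf_updateCol_subset {m n : ℕ} {A B : Matrix (Fin m) (Fin n) ℝ} {z : Fin m → ℝ}
    (hB : coneOf B ⊆ coneOf A) (hz : z ∈ coneOf A) (h : Fin n) :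
    coneOf (B.updateCol h z) ⊆ coneOf A := by
  refine coneOf_subset fun j => ?_
  by_cases hj : j = h
  · subst hj
    convert hz using 1
    ext i
    simp [Matrix.col]
  · convert hB (col_mem_coneOf B j) using 1
    ext i
    simp [Matrix.col, hj]

theorem updateCol_mulVec_update {R : Type*} [CommRing R] {m n : ℕ} (A : Matrix (Fin m) (Fin n) R)
    (h : Fin n) (z : Fin m → R) (r : Fin n → R) (hr : r h = 0) (τ : R) :
    (A.updateCol h z).mulVec (Function.update r h τ) = A.mulVec r + τ • z := by
  ext i
  simp only [Matrix.mulVec, dotProduct, Pi.add_apply, Pi.smul_apply, smul_eq_mul]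
  rw [← Finset.add_sum_erase _ _ (Finset.mem_univ h), ← Finset.add_sum_erase _ _ (Finset.mem_univ h),
    Finset.sum_congr rfl (g := fun j => A i j * r j)]
  · simp [hr]; ring
  · intro j hj
    simp [(Finset.mem_erase.1 hj).1]

theorem det_updateCol_mulVec {R : Type*} [CommRing R] {n : ℕ} (A : Matrix (Fin n) (Fin n) R)
    (h : Fin n) (v : Fin n → R) : (A.updateCol h (A.mulVec v)).det = v h * A.det := by
  rw [← Matrix.cramer_apply, Matrix.cramer_eq_adjugate_mulVec, Matrix.mulVec_mulVec,
    Matrix.adjugate_mul, Matrix.smul_mulVec, Matrix.one_mulVec]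
  simp [mul_comm]

theorem det_updateCol_updateCol_mulVec {R : Type*} [CommRing R] [IsDomain R] {n : ℕ}
    (A : Matrix (Fin n) (Fin n) R) {h l : Fin n} (hl : l ≠ h) (v w : Fin n → R) (hv : v h ≠ 0) :
    ((A.updateCol h (A.mulVec v)).updateCol l (A.mulVec w)).det
      = (v h * w l - w h * v l) * A.det := by
  have key : v h • A.mulVec w = (A.updateCol h (A.mulVec v)).mulVec
      (Function.update (v h • w - w h • v) h (w h)) := by
    rw [updateCol_mulVec_update _ _ _ _ (by simp [mul_comm]), Matrix.mulVec_sub,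
      Matrix.mulVec_smul, Matrix.mulVec_smul]
    simp
  apply mul_left_cancel₀ hv
  rw [← Matrix.det_updateCol_smul, key, det_updateCol_mulVec, det_updateCol_mulVec]
  simp [hl]
  ring

/-- `B` spans a full-dimensional cone inside the cone of `A`, of at most half the index. -/
def IsHalvingPiece {n : ℕ} (A B : Matrix (Fin n) (Fin n) ℤ) : Prop :=
  B.det ≠ 0 ∧ 2 * |B.det| ≤ |A.det| ∧
    coneOf (B.map (Int.cast : ℤ → ℝ)) ⊆ coneOf (A.map (Int.cast : ℤ → ℝ))

theorem map_mulVec_cast {n : ℕ} (A : Matrix (Fin n) (Fin n) ℤ) {p : ℤ} {v z : Fin n → ℤ}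
    (hz : A.mulVec v = p • z) :
    (A.map (Int.cast : ℤ → ℝ)).mulVec (fun j => (v j : ℝ)) = (p : ℝ) • fun j => (z j : ℝ) := by
  ext i
  have h := congrArg (Int.cast : ℤ → ℝ) (congrFun hz i)
  simpa [Matrix.mulVec, dotProduct] using h

theorem map_updateCol_cast {n : ℕ} (A : Matrix (Fin n) (Fin n) ℤ) (h : Fin n) (z : Fin n → ℤ) :
    (A.updateCol h z).map (Int.cast : ℤ → ℝ)
      = (A.map (Int.cast : ℤ → ℝ)).updateCol h (fun j => (z j : ℝ)) := by
  ext i j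
  by_cases hj : j = h
  · subst hj; simp
  · simp [hj]

theorem cast_mem_coneOf {n : ℕ} {A : Matrix (Fin n) (Fin n) ℤ} {p : ℤ} (hp : 0 < p)
    {v z : Fin n → ℤ} (hv : ∀ j, 0 ≤ v j) (hz : A.mulVec v = p • z) :
    (fun j => (z j : ℝ)) ∈ coneOf (A.map (Int.cast : ℤ → ℝ)) := by
  have hp' : (0 : ℝ) < p := by exact_mod_cast hp
  refine ⟨(p : ℝ)⁻¹ • fun j => (v j : ℝ), fun j => ?_, ?_⟩
  · have : (0 : ℝ) ≤ v j := by exact_mod_cast hv j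
    simp only [Pi.smul_apply, smul_eq_mul]
    positivity
  · rw [Matrix.mulVec_smul, map_mulVec_cast A hz, smul_smul, inv_mul_cancel₀ hp'.ne', one_smul]

theorem isHalvingPiece_updateCol {n : ℕ} {A : Matrix (Fin n) (Fin n) ℤ} (hA : A.det ≠ 0) {p : ℤ}
    (hp : 0 < p) {v z : Fin n → ℤ} (hv : ∀ j, 0 ≤ v j) (hz : A.mulVec v = p • z) {h : Fin n}
    (hh : 0 < v h) (hh' : 2 * v h ≤ p) : IsHalvingPiece A (A.updateCol h z) := by
  have hdet : p * (A.updateCol h z).det = v h * A.det := by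
    rw [← Matrix.det_updateCol_smul, ← hz, det_updateCol_mulVec]
  refine ⟨fun h0 => ?_, ?_, ?_⟩
  · rw [h0, mul_zero] at hdet
    exact (mul_ne_zero hh.ne' hA) hdet.symm
  · have habs := congrArg abs hdet
    rw [abs_mul, abs_mul, abs_of_pos hp, abs_of_pos hh] at habs
    have := mul_le_mul_of_nonneg_right hh' (abs_nonneg A.det)
    refine le_of_mul_le_mul_left ?_ hp
    linarith
  · rw [map_updateCol_cast]
    exact coneOf_updateCol_subset subset_rfl (cast_mem_coneOf hp hv hz) h

theorem isHalvingPiece_updateCol_updateCol {n : ℕ} {A : Matrix (Fin n) (Fin n) ℤ}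
    (hA : A.det ≠ 0) {p : ℤ} (hp : 0 < p) {v w z y : Fin n → ℤ} (hv : ∀ j, 0 ≤ v j)
    (hv' : ∀ j, v j < p) (hw : ∀ j, 0 ≤ w j) (hw' : ∀ j, w j < p)
    (hvw : ∀ j, w j = 2 * v j ∨ w j = 2 * v j - p)
    (hz : A.mulVec v = p • z) (hy : A.mulVec w = p • y) {h l : Fin n} (hl : l ≠ h)
    (hh : p < 2 * v h) (hne : v h * w l ≠ w h * v l) :
    IsHalvingPiece A ((A.updateCol h z).updateCol l y) := by
  have hvh : 0 < v h := by linarith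
  have hdet : p * (p * ((A.updateCol h z).updateCol l y).det)
      = (v h * w l - w h * v l) * A.det := by
    rw [← det_updateCol_updateCol_mulVec A hl v w hvh.ne', hz, hy, Matrix.det_updateCol_smul,
      Matrix.updateCol_comm _ hl.symm, Matrix.updateCol_comm _ hl.symm, Matrix.det_updateCol_smul]
  obtain ⟨c, hc, hc2⟩ : ∃ c, v h * w l - w h * v l = p * c ∧ 2 * |c| ≤ p := by
    have hwh : w h = 2 * v h - p := by
      rcases hvw h with h1 | h1
      · linarith [hw' h]
      · exact h1
    have := hv l
    have := hv' l
    have := hv' h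
    have := hw l
    have := hw' l
    rcases hvw l with h1 | h1
    · refine ⟨v l, by rw [h1, hwh]; ring, ?_⟩
      rw [abs_of_nonneg (hv l)]
      linarith
    · refine ⟨v l - v h, by rw [h1, hwh]; ring, ?_⟩
      rcases abs_cases (v l - v h) with h2 | h2 <;> omega
  have hdet' : p * ((A.updateCol h z).updateCol l y).det = c * A.det := by
    apply mul_left_cancel₀ hp.ne'
    rw [hdet, hc]
    ring
  refine ⟨fun h0 => ?_, ?_, ?_⟩
  · rw [h0, mul_zero, mul_zero] at hdet
    exact (mul_ne_zero (sub_ne_zero.2 hne) hA) hdet.symm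
  · have habs := congrArg abs hdet'
    rw [abs_mul, abs_mul, abs_of_pos hp] at habs
    have := mul_le_mul_of_nonneg_right hc2 (abs_nonneg A.det)
    refine le_of_mul_le_mul_left ?_ hp
    linarith
  · rw [map_updateCol_cast, map_updateCol_cast]
    exact coneOf_updateCol_subset (coneOf_updateCol_subset subset_rfl
      (cast_mem_coneOf hp hv hz) h) (cast_mem_coneOf hp hw hy) l

theorem mem_coneOf_updateCol {n : ℕ} {A : Matrix (Fin n) (Fin n) ℤ} {p : ℤ} (hp : 0 < p)
    {v z : Fin n → ℤ} (hz : A.mulVec v = p • z) {h : Fin n} (hh : 0 < v h) {t : Fin n → ℝ}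
    (ht : ∀ j, 0 ≤ t j) (hmin : ∀ j, t h * v j ≤ t j * v h) :
    (A.map (Int.cast : ℤ → ℝ)).mulVec t ∈
      coneOf ((A.updateCol h z).map (Int.cast : ℤ → ℝ)) := by
  have hh' : (0 : ℝ) < v h := by exact_mod_cast hh
  have hp' : (0 : ℝ) < p := by exact_mod_cast hp
  set r : Fin n → ℝ := t - (t h / v h) • fun j => (v j : ℝ) with hr
  have hrh : r h = 0 := by simp [hr, hh'.ne']
  have hr0 : ∀ j, 0 ≤ r j := by
    intro j
    have : t h / v h * v j ≤ t j := by
      rw [div_mul_eq_mul_div, div_le_iff₀ hh']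
      exact hmin j
    simpa [hr] using this
  refine ⟨Function.update r h (t h / v h * p), fun j => ?_, ?_⟩
  · by_cases hj : j = h
    · subst hj
      have := ht j
      simp only [Function.update_self]
      positivity
    · simpa [hj] using hr0 j
  · rw [map_updateCol_cast, updateCol_mulVec_update _ _ _ _ hrh, hr, Matrix.mulVec_sub,
      Matrix.mulVec_smul, map_mulVec_cast A hz, smul_smul]
    simp

theorem mem_coneOf_updateCol_updateCol {n : ℕ} {A : Matrix (Fin n) (Fin n) ℤ} {p : ℤ}
    (hp : 0 < p) {v w z y : Fin n → ℤ} (hz : A.mulVec v = p • z) (hy : A.mulVec w = p • y)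
    {h : Fin n} (hvh : 0 < v h) (hwh : 0 < w h) {t : Fin n → ℝ} (ht : ∀ j, 0 ≤ t j)
    (hmin : ∀ j, t h * v j ≤ t j * v h) (hnot : ¬ ∀ j, t h * w j ≤ t j * w h) :
    ∃ l, l ≠ h ∧ v h * w l ≠ w h * v l ∧ (A.map (Int.cast : ℤ → ℝ)).mulVec t ∈
      coneOf (((A.updateCol h z).updateCol l y).map (Int.cast : ℤ → ℝ)) := by
  have hvh' : (0 : ℝ) < v h := by exact_mod_cast hvh
  have hwh' : (0 : ℝ) < w h := by exact_mod_cast hwh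
  have hp' : (0 : ℝ) < p := by exact_mod_cast hp
  push Not at hnot
  set α : Fin n → ℝ := fun j => t j - t h / v h * v j with hα
  set β : Fin n → ℝ := fun j => t j - t h / w h * w j with hβ
  have hα0 : ∀ j, 0 ≤ α j := by
    intro j
    have : t h / v h * v j ≤ t j := by
      rw [div_mul_eq_mul_div, div_le_iff₀ hvh']
      exact hmin j
    simpa [hα] using this
  have hβ0 : ∃ j, β j < 0 := by
    obtain ⟨j, hj⟩ := hnot
    refine ⟨j, ?_⟩
    have : t j < t h / w h * w j := by
      rw [div_mul_eq_mul_div, lt_div_iff₀ hwh']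
      exact hj
    simpa [hβ] using this
  have hαh : α h = 0 := by simp [hα, hvh'.ne']
  have hβh : β h = 0 := by simp [hβ, hwh'.ne']
  obtain ⟨s, hs0, hs1, hs, l, hl, hsl⟩ := exists_first_zero α β hα0 hβ0
  have hlh : l ≠ h := by
    rintro rfl
    exact hl.ne hβh
  refine ⟨l, hlh, fun heq => ?_, ?_⟩
  · have heq' : (v h : ℝ) * w l = w h * v l := by exact_mod_cast heq
    have : α l = β l := by
      simp only [hα, hβ]
      field_simp
      linear_combination t h * heq'
    linarith [hα0 l]
  set r : Fin n → ℝ := fun j => (1 - s) * α j + s * β j with hr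
  have hrh : r h = 0 := by simp [hr, hαh, hβh]
  have hth := ht h
  have h1s := sub_nonneg.2 hs1
  refine ⟨Function.update (Function.update r h ((1 - s) * (t h / v h) * p)) l
    (s * (t h / w h) * p), fun j => ?_, ?_⟩
  · by_cases hj : j = l
    · subst hj
      simp only [Function.update_self]
      positivity
    · by_cases hj' : j = h
      · subst hj'
        simp only [Function.update_of_ne hj, Function.update_self]
        positivity
      · simpa [hj, hj'] using hs j
  · have hrt : r = t - ((1 - s) * (t h / v h)) • (fun j => (v j : ℝ))
        - (s * (t h / w h)) • (fun j => (w j : ℝ)) := by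
      ext j
      simp only [hr, hα, hβ, Pi.sub_apply, Pi.smul_apply, smul_eq_mul]
      ring
    rw [map_updateCol_cast, map_updateCol_cast,
      updateCol_mulVec_update _ _ _ _ (by simpa [hlh] using hsl),
      updateCol_mulVec_update _ _ _ _ hrh, hrt, Matrix.mulVec_sub, Matrix.mulVec_sub,
      Matrix.mulVec_smul, Matrix.mulVec_smul, map_mulVec_cast A hz, map_mulVec_cast A hy,
      smul_smul, smul_smul]
    abel

/-- The combination of the columns of `A` with coefficients `u / p`, where `u` is represented in
`[0, p)`. -/
def residuePoint {n : ℕ} (A : Matrix (Fin n) (Fin n) ℤ) (p : ℕ) (u : Fin n → ZMod p) :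
    Fin n → ℤ :=
  fun i => A.mulVec (fun j => ((u j).val : ℤ)) i / p

theorem mulVec_val_eq_smul_residuePoint {n : ℕ} (A : Matrix (Fin n) (Fin n) ℤ) (p : ℕ) [NeZero p]
    (u : Fin n → ZMod p) (hu : (A.map (Int.cast : ℤ → ZMod p)).mulVec u = 0) :
    A.mulVec (fun j => ((u j).val : ℤ)) = (p : ℤ) • residuePoint A p u := by
  ext i
  have h : (p : ℤ) ∣ A.mulVec (fun j => ((u j).val : ℤ)) i := by
    rw [← ZMod.intCast_zmod_eq_zero_iff_dvd, ← Pi.zero_apply (M := fun _ => ZMod p) i, ← hu]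
    simp [Matrix.mulVec, dotProduct]
  rw [Pi.smul_apply, smul_eq_mul]
  exact (Int.mul_ediv_cancel' h).symm

theorem val_two_mul {p : ℕ} [NeZero p] (a : ZMod p) :
    ((2 * a).val : ℤ) = 2 * a.val ∨ ((2 * a).val : ℤ) = 2 * a.val - p := by
  rw [two_mul]
  rcases lt_or_ge (a.val + a.val) p with h | h
  · left
    rw [ZMod.val_add_of_lt h]
    push_cast; ring
  · right
    have := ZMod.val_add_val_of_le h
    omega

open Finset in
theorem exists_halving_cover {n : ℕ} (A : Matrix (Fin n) (Fin n) ℤ) (hA : A.det ≠ 0)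
    (hA1 : A.det.natAbs ≠ 1) :
    ∃ S : Finset (Matrix (Fin n) (Fin n) ℤ), S.card ≤ n ^ 2 ∧ (∀ B ∈ S, IsHalvingPiece A B) ∧
      coneOf (A.map (Int.cast : ℤ → ℝ)) ⊆ ⋃ B ∈ S, coneOf (B.map (Int.cast : ℤ → ℝ)) := by
  classical
  set p := A.det.natAbs.minFac with hpdef
  have : Fact p.Prime := ⟨Nat.minFac_prime hA1⟩
  have hp0 : (0 : ℤ) < p := by exact_mod_cast (Fact.out : p.Prime).pos
  obtain ⟨u, hu0, hu⟩ : ∃ u : Fin n → ZMod p, u ≠ 0 ∧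
      (A.map (Int.cast : ℤ → ZMod p)).mulVec u = 0 := by
    rw [Matrix.exists_mulVec_eq_zero_iff]
    have hd : ((A.det : ℤ) : ZMod p) = 0 := by
      rw [ZMod.intCast_zmod_eq_zero_iff_dvd, Int.natCast_dvd]
      exact Nat.minFac_dvd _
    rw [← hd]
    exact (Int.cast_det A).symm
  obtain ⟨m, hm, hsum⟩ := exists_mul_sum_doublingLevel_le p u
  let U : ℕ → Fin n → ZMod p := fun i j => 2 ^ i * (m * u j)
  let V : ℕ → Fin n → ℤ := fun i j => ((U i j).val : ℤ)
  let Z : ℕ → Fin n → ℤ := fun i => residuePoint A p (U i)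
  let N : Fin n → ℕ := fun h => doublingLevel p (m * u h)
  have hZ : ∀ i, A.mulVec (V i) = (p : ℤ) • Z i := by
    intro i
    refine mulVec_val_eq_smul_residuePoint A p (U i) ?_
    have : U i = (2 ^ i * m) • u := by
      ext j
      simp [U, mul_assoc]
    rw [this, Matrix.mulVec_smul, hu, smul_zero]
  have hV0 : ∀ i j, 0 ≤ V i j := fun i j => Int.natCast_nonneg _
  have hVp : ∀ i j, V i j < p := fun i j => Int.ofNat_lt.2 (ZMod.val_lt (U i j))
  have hVV : ∀ i j, V (i + 1) j = 2 * V i j ∨ V (i + 1) j = 2 * V i j - p := by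
    intro i j
    have : U (i + 1) j = 2 * U i j := by simp only [U]; ring
    simp only [V, this]
    exact val_two_mul _
  have hval : ∀ h, u h ≠ 0 → ∀ i ≤ N h, V i h + 2 ^ i * (-(m * u h)).val = p := by
    intro h hh i hi
    have := val_two_pow_mul (mul_ne_zero hm hh) hi
    zify at this
    exact this
  have hpos : ∀ h, u h ≠ 0 → ∀ i ≤ N h, 0 < V i h := by
    intro h hh i hi
    have h1 := hval h hh i hi
    have h2 := two_pow_mul_val_neg_lt (mul_ne_zero hm hh) hi
    zify at h2
    linarith
  have hbig : ∀ h, u h ≠ 0 → ∀ i < N h, (p : ℤ) < 2 * V i h := by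
    intro h hh i hi
    have h1 := hval h hh i hi.le
    have h2 := (lt_doublingLevel_iff (mul_ne_zero hm hh) i).1 hi
    rw [pow_succ] at h2
    zify at h2
    linarith
  have hsmall : ∀ h, u h ≠ 0 → 2 * V (N h) h ≤ p := by
    intro h hh
    have h1 := hval h hh (N h) le_rfl
    have h2 := mt (lt_doublingLevel_iff (mul_ne_zero hm hh) (N h)).2 (lt_irrefl _)
    rw [pow_succ] at h2
    zify at h2
    linarith
  let S₁ : Finset (Matrix (Fin n) (Fin n) ℤ) := univ.image fun h => A.updateCol h (Z (N h))
  let S₂ : Finset (Matrix (Fin n) (Fin n) ℤ) :=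
    univ.biUnion fun h => (range (N h)).biUnion fun i =>
      (univ.erase h).image fun l => (A.updateCol h (Z i)).updateCol l (Z (i + 1))
  refine ⟨(S₁ ∪ S₂).filter (IsHalvingPiece A), ?_, fun B hB => (mem_filter.1 hB).2, ?_⟩
  · have h1 : S₁.card ≤ n := card_image_le.trans (by simp)
    have h2 : S₂.card ≤ n * (n - 1) := by
      calc S₂.card ≤ ∑ h, N h * (n - 1) := by
            refine card_biUnion_le.trans (sum_le_sum fun h _ => ?_)
            refine (card_biUnion_le_card_mul _ _ (n - 1) fun i _ => ?_).trans (by simp)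
            exact card_image_le.trans (by simp [card_erase_of_mem])
        _ = (∑ h, N h) * (n - 1) := by rw [sum_mul]
        _ ≤ n * (n - 1) := Nat.mul_le_mul_right _ hsum
    calc _ ≤ (S₁ ∪ S₂).card := card_filter_le _ _
      _ ≤ n + n * (n - 1) := (card_union_le _ _).trans (Nat.add_le_add h1 h2)
      _ = n ^ 2 := by
        rcases n with _ | n
        · rfl
        · simp; ring
  · rintro x ⟨t, ht, rfl⟩
    have hstep : ∀ d i h, u h ≠ 0 → i + d = N h →
        (∀ j, t h * V i j ≤ t j * V i h) →
        ∃ B ∈ (S₁ ∪ S₂).filter (IsHalvingPiece A), (A.map (Int.cast : ℤ → ℝ)).mulVec t ∈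
          coneOf (B.map (Int.cast : ℤ → ℝ)) := by
      intro d
      induction d with
      | zero =>
        intro i h hh hi hmin
        obtain rfl : i = N h := by omega
        exact ⟨A.updateCol h (Z (N h)), mem_filter.2 ⟨mem_union_left _
          (mem_image_of_mem _ (mem_univ h)), isHalvingPiece_updateCol hA hp0 (hV0 _) (hZ _)
          (hpos h hh _ le_rfl) (hsmall h hh)⟩,
          mem_coneOf_updateCol hp0 (hZ _) (hpos h hh _ le_rfl) ht hmin⟩
      | succ d ih =>
        intro i h hh hi hmin
        by_cases hnext : ∀ j, t h * V (i + 1) j ≤ t j * V (i + 1) h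
        · exact ih (i + 1) h hh (by omega) hnext
        obtain ⟨l, hl, hne, hmem⟩ := mem_coneOf_updateCol_updateCol hp0 (hZ i) (hZ (i + 1))
          (hpos h hh i (by omega)) (hpos h hh (i + 1) (by omega)) ht hmin hnext
        refine ⟨_, mem_filter.2 ⟨mem_union_right _ ?_, isHalvingPiece_updateCol_updateCol hA hp0
          (hV0 i) (hVp i) (hV0 _) (hVp _) (hVV i) (hZ i) (hZ _) hl (hbig h hh i (by omega)) hne⟩,
          hmem⟩
        exact mem_biUnion.2 ⟨h, mem_univ h, mem_biUnion.2 ⟨i, mem_range.2 (by omega),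
          mem_image_of_mem _ (mem_erase.2 ⟨hl, mem_univ l⟩)⟩⟩
    obtain ⟨j₀, hj₀⟩ := Function.ne_iff.1 hu0
    obtain ⟨h, hh, hmin⟩ := exists_min_image (univ.filter fun j => u j ≠ 0)
      (fun j => t j / V 0 j) ⟨j₀, by simpa using hj₀⟩
    simp only [mem_filter, mem_univ, true_and] at hh hmin
    have hpos' : ∀ j, u j ≠ 0 → (0 : ℝ) < V 0 j := fun j hj => by
      exact_mod_cast hpos j hj 0 (Nat.zero_le _)
    obtain ⟨B, hB, hmem⟩ := hstep (N h) 0 h hh (Nat.zero_add _) fun j => by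
      by_cases hj : u j = 0
      · have : V 0 j = 0 := by simp [V, U, hj]
        rw [this]
        have := mul_nonneg (ht j) (hpos' h hh).le
        simpa using this
      · have := hmin j hj
        rwa [div_le_div_iff₀ (hpos' h hh) (hpos' j hj)] at this
    exact Set.mem_biUnion hB hmem

theorem exists_unimodular_cover {n : ℕ} (D : ℕ) (A : Matrix (Fin n) (Fin n) ℤ)
    (hA : A.det ≠ 0) (hD : A.det.natAbs = D) :
    ∃ S : Finset (Matrix (Fin n) (Fin n) ℤ),
      (S.card : ℝ) ≤ (n : ℝ) ^ ((2 : ℝ) * Real.logb 2 (D : ℝ)) ∧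
      (∀ B ∈ S, B.det.natAbs = 1) ∧
      coneOf (A.map (Int.cast : ℤ → ℝ)) = ⋃ B ∈ S, coneOf (B.map (Int.cast : ℤ → ℝ)) := by
  classical
  induction D using Nat.strong_induction_on generalizing A with
  | _ D ih =>
  by_cases hA1 : A.det.natAbs = 1
  · exact ⟨{A}, by simp [← hD, hA1], by simpa using hA1, by simp⟩
  have hn : 1 ≤ n := by
    rcases n with _ | n
    · simp at hA1
    · omega
  have hD0 : 0 < D := by omega
  have hn' : (1 : ℝ) ≤ n := by exact_mod_cast hn
  obtain ⟨S, hcard, hS, hcover⟩ := exists_halving_cover A hA hA1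
  have hhalf : ∀ B ∈ S, 2 * B.det.natAbs ≤ D := by
    intro B hB
    have := (hS B hB).2.1
    zify
    rwa [← hD, Int.natCast_natAbs]
  have hpiece : ∀ B ∈ S, ∃ T : Finset (Matrix (Fin n) (Fin n) ℤ),
      (T.card : ℝ) ≤ (n : ℝ) ^ ((2 : ℝ) * Real.logb 2 (D / 2 : ℝ)) ∧
      (∀ B' ∈ T, B'.det.natAbs = 1) ∧
      coneOf (B.map (Int.cast : ℤ → ℝ)) = ⋃ B' ∈ T, coneOf (B'.map (Int.cast : ℤ → ℝ)) := by
    intro B hB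
    have hB0 : 0 < B.det.natAbs := Int.natAbs_pos.2 (hS B hB).1
    have hle := hhalf B hB
    obtain ⟨T, hT, hT1, hT2⟩ := ih B.det.natAbs (by omega) B (hS B hB).1 rfl
    refine ⟨T, hT.trans ?_, hT1, hT2⟩
    have h1 : (B.det.natAbs : ℝ) ≤ D / 2 := by
      rw [le_div_iff₀ (by norm_num)]
      exact_mod_cast (by omega : B.det.natAbs * 2 ≤ D)
    have h2 : (0 : ℝ) < B.det.natAbs := by exact_mod_cast hB0
    refine Real.rpow_le_rpow_of_exponent_le hn' (mul_le_mul_of_nonneg_left ?_ (by norm_num))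
    exact Real.logb_le_logb_of_le (by norm_num) h2 h1
  choose! T hT hT1 hT2 using hpiece
  refine ⟨S.biUnion T, ?_, ?_, ?_⟩
  · calc ((S.biUnion T).card : ℝ) ≤ ∑ B ∈ S, ((T B).card : ℝ) := by
          exact_mod_cast Finset.card_biUnion_le
      _ ≤ ∑ _B ∈ S, (n : ℝ) ^ ((2 : ℝ) * Real.logb 2 (D / 2 : ℝ)) := Finset.sum_le_sum hT
      _ = S.card * (n : ℝ) ^ ((2 : ℝ) * Real.logb 2 (D / 2 : ℝ)) := by simp
      _ ≤ (n : ℝ) ^ (2 : ℝ) * (n : ℝ) ^ ((2 : ℝ) * Real.logb 2 (D / 2 : ℝ)) := by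
          gcongr
          rw [Real.rpow_two]
          exact_mod_cast hcard
      _ = (n : ℝ) ^ ((2 : ℝ) * Real.logb 2 (D : ℝ)) := by
          rw [← Real.rpow_add (by linarith), Real.logb_div (by positivity) (by norm_num),
            Real.logb_self_eq_one (by norm_num)]
          ring_nf
  · intro B hB
    obtain ⟨C, hC, hBC⟩ := Finset.mem_biUnion.1 hB
    exact hT1 C hC B hBC
  · rw [Finset.set_biUnion_biUnion, ← Set.iUnion₂_congr hT2]
    exact hcover.antisymm (Set.iUnion₂_subset fun B hB => (hS B hB).2.2)

/-- Every simplicial cone `cone(A)` with `|det A| = Δ > 0` can be decomposed as the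
union of at most `n^(2 log₂ Δ)` unimodular cones. -/
theorem unimodular_cone_decomposition
    (n : ℕ) (A : Matrix (Fin n) (Fin n) ℤ) (hA : A.det ≠ 0) :
    ∃ (s : ℕ) (B : Fin s → Matrix (Fin n) (Fin n) ℤ),
      (s : ℝ) ≤ (n : ℝ) ^ ((2 : ℝ) * Real.logb 2 (A.det.natAbs : ℝ)) ∧
      (∀ j, (B j).det = 1 ∨ (B j).det = -1) ∧
      coneOf (A.map (Int.cast : ℤ → ℝ)) =
        ⋃ j, coneOf ((B j).map (Int.cast : ℤ → ℝ)) := by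
  obtain ⟨S, hcard, hS, hcover⟩ := exists_unimodular_cover _ A hA rfl
  refine ⟨S.card, fun j => S.equivFin.symm j, hcard,
    fun j => Int.natAbs_eq_iff.1 (hS _ (S.equivFin.symm j).2), ?_⟩
  rw [hcover, S.equivFin.symm.surjective.iUnion_comp
    fun B : S => coneOf ((B : Matrix (Fin n) (Fin n) ℤ).map (Int.cast : ℤ → ℝ)),
    Set.iUnion_subtype]
end

section
/- Let $p \in \mathbb{Z}^n$, $B \in \mathbb{Z}^{n \times n}$ with $\det(B) \ne 0$, $A \in \mathbb{Z}^{m \times n}$, $b \in \mathbb{Z}^m$, and suppose that for every $i \in \{1,\dots,m\}$ the transposed $i$-th row of $A$ lies in $\mathrm{cone}((B^{-1})^\top)$. Then $P(A,b) \cap (p + \mathrm{cone}(B)) \cap \mathbb{Z}^n \ne \emptyset$ if and only if $p \in P(A,b)$. -/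
/-- Vectors of the cone spanned by `M` pair nonnegatively with those of the cone spanned by
`(M⁻¹)ᵀ`, its dual cone. -/
theorem dotProduct_nonneg_of_mem_coneOf_inv_transpose {n : ℕ} {M : Matrix (Fin n) (Fin n) ℝ}
    (hM : IsUnit M.det) {u v : Fin n → ℝ} (hu : u ∈ coneOf M⁻¹.transpose) (hv : v ∈ coneOf M) :
    0 ≤ u ⬝ᵥ v := by
  obtain ⟨t, ht, rfl⟩ := hu
  obtain ⟨s, hs, rfl⟩ := hv
  rw [Matrix.mulVec_transpose, ← Matrix.dotProduct_mulVec, Matrix.mulVec_mulVec,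
    Matrix.nonsing_inv_mul _ hM, Matrix.one_mulVec]
  exact Finset.sum_nonneg fun j _ => mul_nonneg (ht j) (hs j)

/-- If every row of `A` (transposed) lies in `cone((B⁻¹)ᵀ)`, then
`P(A,b) ∩ (p + cone(B)) ∩ ℤⁿ ≠ ∅` iff `p ∈ P(A,b)`. -/
theorem unimodular_cone_section_feasibility
    (m n : ℕ) (p : Fin n → ℤ) (B : Matrix (Fin n) (Fin n) ℤ) (hB : B.det ≠ 0)
    (A : Matrix (Fin m) (Fin n) ℤ) (b : Fin m → ℤ)
    (hrows : ∀ i, (fun j => (A i j : ℝ)) ∈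
      coneOf (((B.map (Int.cast : ℤ → ℝ))⁻¹).transpose)) :
    (∃ x : Fin n → ℤ,
        (∀ i, (∑ j, (A i j : ℝ) * x j) ≤ (b i : ℝ)) ∧
        (fun j => (x j : ℝ) - (p j : ℝ)) ∈ coneOf (B.map (Int.cast : ℤ → ℝ))) ↔
      (∀ i, (∑ j, (A i j : ℝ) * p j) ≤ (b i : ℝ)) := by
  constructor
  · rintro ⟨x, hx, hxp⟩ i
    have hdet : IsUnit (B.map (Int.cast : ℤ → ℝ)).det := by
      rw [← Int.cast_det, isUnit_iff_ne_zero]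
      exact_mod_cast hB
    have h := dotProduct_nonneg_of_mem_coneOf_inv_transpose hdet (hrows i) hxp
    simp only [dotProduct, mul_sub, Finset.sum_sub_distrib] at h
    linarith [hx i]
  · intro hp
    exact ⟨p, hp, 0, fun _ => le_rfl, by ext; simp⟩
end

section
/- Let $A \in \mathbb{Z}^{(n+1) \times n}$, $b \in \mathbb{Z}^{n+1}$, and suppose $P = P(A,b)$ is an $n$-dimensional simplex. Then the lattice width of $P$ satisfies $w(P) = \min_{v, u \in \mathrm{vert}(P),\, v \neq u}\; \min_{c \in M(v,u)} c^\top (v - u)$, where $M(v,u) = N(v) \cap (-N(u)) \cap \mathbb{Z}^n \setminus \{0\}$. -/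
open scoped BigOperators

/-- The normal cone of a point `v` of `P(A,b)`: the cone of nonnegative combinations
of the rows of `A` active at `v`. -/
def normalCone {m n : ℕ} (A : Matrix (Fin m) (Fin n) ℝ) (b : Fin m → ℝ)
    (v : Fin n → ℝ) : Set (Fin n → ℝ) :=
  {c | ∃ t : Fin m → ℝ, (∀ j, 0 ≤ t j) ∧
        (∀ j, t j ≠ 0 → (∑ i, A j i * v i) = b j) ∧
        c = fun i => ∑ j, t j * A j i}

open Matrix

/-- A direction along which no active constraint increases is feasible. -/
theorem exists_pos_mulVec_add_smul_le {ι κ : Type*} [Finite ι] [Fintype κ]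
    {A : Matrix ι κ ℝ} {b : ι → ℝ} {v d : κ → ℝ} (hv : ∀ i, (A *ᵥ v) i ≤ b i)
    (hd : ∀ i, (A *ᵥ v) i = b i → (A *ᵥ d) i ≤ 0) :
    ∃ ε : ℝ, 0 < ε ∧ ∀ i, (A *ᵥ (v + ε • d)) i ≤ b i := by
  have h : ∀ i, ∀ᶠ ε in nhdsWithin (0 : ℝ) (Set.Ioi 0), (A *ᵥ (v + ε • d)) i ≤ b i := by
    intro i
    simp only [mulVec_add, mulVec_smul, Pi.add_apply, Pi.smul_apply, smul_eq_mul]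
    rcases (hv i).eq_or_lt with hi | hi
    · filter_upwards [self_mem_nhdsWithin] with ε hε
      nlinarith [hd i hi, Set.mem_Ioi.1 hε]
    · have hc : Filter.Tendsto (fun ε : ℝ => (A *ᵥ v) i + ε * (A *ᵥ d) i) (nhds 0)
          (nhds ((A *ᵥ v) i + 0 * (A *ᵥ d) i)) := by
        apply Continuous.tendsto (f := fun ε : ℝ => (A *ᵥ v) i + ε * (A *ᵥ d) i)
        fun_prop
      rw [zero_mul, add_zero] at hc
      exact nhdsWithin_le_nhds ((hc.eventually_lt_const hi).mono fun _ => le_of_lt)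
  obtain ⟨ε, h₁, h₂⟩ := ((Filter.eventually_all.2 h).and self_mem_nhdsWithin).exists
  exact ⟨ε, h₂, h₁⟩

/-- The active constraints at an extreme point of a polyhedron determine a direction. -/
theorem eq_zero_of_mulVec_active_eq_zero {ι κ : Type*} [Finite ι] [Fintype κ]
    {A : Matrix ι κ ℝ} {b : ι → ℝ} {v d : κ → ℝ}
    (hv : v ∈ Set.extremePoints ℝ {x | ∀ i, (A *ᵥ x) i ≤ b i})
    (hd : ∀ i, (A *ᵥ v) i = b i → (A *ᵥ d) i = 0) : d = 0 := by
  obtain ⟨ε, hε, h₁⟩ := exists_pos_mulVec_add_smul_le (d := d) hv.1 fun i hi => (hd i hi).le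
  obtain ⟨δ, hδ, h₂⟩ := exists_pos_mulVec_add_smul_le (d := -d) hv.1 fun i hi => by
    simp [mulVec_neg, hd i hi]
  have hseg : v ∈ openSegment ℝ (v + ε • d) (v + δ • -d) := by
    refine ⟨δ / (ε + δ), ε / (ε + δ), by positivity, by positivity, by field_simp; ring, ?_⟩
    ext i
    simp only [Pi.add_apply, Pi.smul_apply, Pi.neg_apply, smul_eq_mul]
    field_simp
    ring
  have h := hv.2 h₁ h₂ hseg
  simpa [hε.ne'] using h

/-- In a bounded polyhedron with more than one point, some constraint is inactive at any
given point. -/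
theorem exists_mulVec_ne_of_isBounded {ι κ : Type*} [Fintype κ]
    {A : Matrix ι κ ℝ} {b : ι → ℝ} {v u : κ → ℝ}
    (hP : Bornology.IsBounded {x | ∀ i, (A *ᵥ x) i ≤ b i})
    (hu : ∀ i, (A *ᵥ u) i ≤ b i) (hne : v ≠ u) : ∃ i, (A *ᵥ v) i ≠ b i := by
  by_contra! h
  obtain ⟨R, hR⟩ := hP.exists_norm_le
  have hpos : 0 < ‖u - v‖ := norm_pos_iff.2 (sub_ne_zero.2 hne.symm)
  have hR0 : 0 ≤ R := (norm_nonneg v).trans (hR v fun i => (h i).le)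
  have ht : 0 ≤ (R + ‖v‖ + 1) / ‖u - v‖ := by positivity
  have hmem := hR (v + ((R + ‖v‖ + 1) / ‖u - v‖) • (u - v)) fun i => by
    simp only [mulVec_add, mulVec_smul, mulVec_sub, Pi.add_apply, Pi.smul_apply, Pi.sub_apply,
      smul_eq_mul, h i]
    nlinarith [hu i]
  have hle := norm_sub_le (v + ((R + ‖v‖ + 1) / ‖u - v‖) • (u - v)) v
  rw [add_sub_cancel_left, norm_smul, Real.norm_of_nonneg ht, div_mul_cancel₀ _ hpos.ne'] at hle
  linarith

theorem dotProduct_le_of_mem_normalCone {m n : ℕ} {A : Matrix (Fin m) (Fin n) ℝ}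
    {b : Fin m → ℝ} {v x c : Fin n → ℝ} (hc : c ∈ normalCone A b v)
    (hx : ∀ i, (A *ᵥ x) i ≤ b i) : c ⬝ᵥ x ≤ c ⬝ᵥ v := by
  obtain ⟨t, ht, hact, rfl⟩ := hc
  have key : ∀ y, (fun i => ∑ j, t j * A j i) ⬝ᵥ y = ∑ j, t j * (A *ᵥ y) j := by
    intro y
    exact (dotProduct_mulVec t A y).symm
  rw [key, key]
  refine Finset.sum_le_sum fun j _ => ?_
  by_cases hj : t j = 0
  · simp [hj]
  · have hv : (A *ᵥ v) j = b j := hact j hj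
    rw [hv]
    exact mul_le_mul_of_nonneg_left (hx j) (ht j)

/-- At a vertex of a bounded polyhedron in dimension `n` with `n + 1` constraints, every
objective maximized there lies in the normal cone. -/
theorem mem_normalCone_of_forall_dotProduct_le {n : ℕ} {A : Matrix (Fin (n + 1)) (Fin n) ℝ}
    {b : Fin (n + 1) → ℝ} {v u c : Fin n → ℝ}
    (hP : Bornology.IsBounded {x | ∀ i, (A *ᵥ x) i ≤ b i})
    (hv : v ∈ Set.extremePoints ℝ {x | ∀ i, (A *ᵥ x) i ≤ b i})
    (hu : ∀ i, (A *ᵥ u) i ≤ b i) (hne : v ≠ u)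
    (hmax : ∀ x, (∀ i, (A *ᵥ x) i ≤ b i) → c ⬝ᵥ x ≤ c ⬝ᵥ v) : c ∈ normalCone A b v := by
  classical
  let J := {i // (A *ᵥ v) i = b i}
  let L : (Fin n → ℝ) →ₗ[ℝ] (J → ℝ) := (A.submatrix Subtype.val id).mulVecLin
  have hL : ∀ x (j : J), L x j = (A *ᵥ x) j := fun _ _ => rfl
  have hinj : Function.Injective L := by
    rw [← LinearMap.ker_eq_bot, LinearMap.ker_eq_bot']
    intro d hd
    exact eq_zero_of_mulVec_active_eq_zero hv fun i hi => by
      rw [← hL d ⟨i, hi⟩, hd, Pi.zero_apply]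
  obtain ⟨k, hk⟩ := exists_mulVec_ne_of_isBounded hP hu hne
  have hlt : Fintype.card J < n + 1 := by
    simpa using Fintype.card_subtype_lt (p := fun i => (A *ᵥ v) i = b i) hk
  have hge := LinearMap.finrank_le_finrank_of_injective hinj
  have hfin : Module.finrank ℝ (Fin n → ℝ) = Module.finrank ℝ (J → ℝ) := by
    simp only [Module.finrank_fintype_fun_eq_card, Fintype.card_fin] at hge ⊢
    omega
  let E := LinearEquiv.ofInjectiveOfFinrankEq L hinj hfin
  have hE : ∀ x, E x = L x := fun _ => rfl
  let s : J → ℝ := fun j => c ⬝ᵥ E.symm (Pi.single j 1)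
  have hs : ∀ j, 0 ≤ s j := by
    intro j
    obtain ⟨ε, hε, h⟩ := exists_pos_mulVec_add_smul_le (d := -E.symm (Pi.single j 1)) hv.1
      fun i hi => by
        rw [mulVec_neg, Pi.neg_apply, ← hL _ ⟨i, hi⟩, ← hE, E.apply_symm_apply, neg_nonpos]
        exact (Pi.single_nonneg.2 zero_le_one : (0 : J → ℝ) ≤ Pi.single j 1) ⟨i, hi⟩
    have hle := hmax _ h
    rw [dotProduct_add, dotProduct_smul, dotProduct_neg, smul_eq_mul] at hle
    change 0 ≤ c ⬝ᵥ E.symm (Pi.single j 1)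
    nlinarith
  have hc : ∀ x, c ⬝ᵥ x = ∑ j : J, s j * (A *ᵥ x) j := by
    intro x
    have hx : x = ∑ j : J, (A *ᵥ x) j • E.symm (Pi.single j 1) := by
      apply E.injective
      simp only [map_sum, map_smul, E.apply_symm_apply]
      ext j
      simp only [hE, hL, Finset.sum_apply, Pi.smul_apply, Pi.single_apply, smul_eq_mul, mul_ite,
        mul_one, mul_zero]
      exact (Fintype.sum_ite_eq j fun j : J => (A *ᵥ x) j).symm
    conv_lhs => rw [hx]
    simp [dotProduct_sum, s, mul_comm]
  refine ⟨fun i => if hi : (A *ᵥ v) i = b i then s ⟨i, hi⟩ else 0, ?_, ?_, ?_⟩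
  · intro j
    dsimp only
    split_ifs with hj
    exacts [hs _, le_rfl]
  · intro j hj
    by_contra hne'
    exact hj (dif_neg hne')
  · ext i
    have h := hc (Pi.single i 1)
    simp only [dotProduct_single, mulVec_single, mul_one] at h
    rw [h, ← Fintype.sum_subtype_add_sum_subtype (fun j => (A *ᵥ v) j = b j)]
    have h₁ : ∀ j : {j // ¬ (A *ᵥ v) j = b j}, ¬ (A *ᵥ v) j = b j := Subtype.prop
    have h₂ : ∀ j : J, (A *ᵥ v) j = b j := Subtype.prop
    simp [h₁, h₂, J]

/-- A continuous linear functional attains its maximum over a compact set at an extreme point. -/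
theorem exists_extremePoint_forall_dotProduct_le {κ : Type*} [Fintype κ] {P : Set (κ → ℝ)}
    (hP : IsCompact P) (hne : P.Nonempty) (c : κ → ℝ) :
    ∃ v ∈ Set.extremePoints ℝ P, ∀ x ∈ P, c ⬝ᵥ x ≤ c ⬝ᵥ v := by
  let f : StrongDual ℝ (κ → ℝ) := LinearMap.toContinuousLinearMap (dotProductBilin ℝ ℝ c)
  have hf : ∀ x, f x = c ⬝ᵥ x := fun _ => rfl
  have hexp : IsExposed ℝ P (f.toExposed P) := ContinuousLinearMap.toExposed.isExposed
  obtain ⟨y, hy, hmax⟩ := hP.exists_isMaxOn hne f.continuous.continuousOn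
  obtain ⟨v, hv⟩ := (hexp.isCompact hP).extremePoints_nonempty ⟨y, hy, hmax⟩
  exact ⟨v, hexp.isExtreme.extremePoints_subset_extremePoints hv, fun x hx => hv.1.2 x hx⟩

/-- A linear functional constant on a set affinely spanning the space vanishes. -/
theorem eq_zero_of_forall_dotProduct_eq {κ : Type*} [Fintype κ] {P : Set (κ → ℝ)}
    (hP : affineSpan ℝ P = ⊤) {c : κ → ℝ} {r : ℝ} (hc : ∀ x ∈ P, c ⬝ᵥ x = r) : c = 0 := by
  have hspan : vectorSpan ℝ P = ⊤ := by
    rw [← direction_affineSpan, hP, AffineSubspace.direction_top]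
  have hle : vectorSpan ℝ P ≤ LinearMap.ker (dotProductBilin ℝ ℝ c) := by
    refine Submodule.span_le.2 ?_
    rintro _ ⟨x, hx, y, hy, rfl⟩
    change c ⬝ᵥ (x - y) = 0
    rw [dotProduct_sub, hc x hx, hc y hy, sub_self]
  rw [hspan] at hle
  exact dotProduct_eq_zero c fun y => hle (Submodule.mem_top (x := y))

/-- For an `n`-dimensional simplex `P = P(A,b)`, the lattice width of `P` equals the
minimum, over all pairs of distinct vertices `v, u` of `P` and all
`c ∈ M(v,u) = N(v) ∩ (-N(u)) ∩ ℤⁿ \ {0}`, of `cᵀ(v - u)`. -/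
theorem width_eq_min_over_vertex_pairs
    (n : ℕ) (A : Matrix (Fin (n + 1)) (Fin n) ℤ) (b : Fin (n + 1) → ℤ)
    (P : Set (Fin n → ℝ))
    (hP : P = {x : Fin n → ℝ | ∀ i, (∑ j, (A i j : ℝ) * x j) ≤ (b i : ℝ)})
    (hsimplex : ∃ w : Fin (n + 1) → (Fin n → ℝ),
      AffineIndependent ℝ w ∧ P = convexHull ℝ (Set.range w)) :
    sInf {w : ℝ | ∃ c : Fin n → ℤ, c ≠ 0 ∧
        w = sSup ((fun x : Fin n → ℝ => ∑ i, (c i : ℝ) * x i) '' P)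
              - sInf ((fun x : Fin n → ℝ => ∑ i, (c i : ℝ) * x i) '' P)}
      = sInf {w : ℝ | ∃ v ∈ Set.extremePoints ℝ P, ∃ u ∈ Set.extremePoints ℝ P,
          v ≠ u ∧ ∃ c : Fin n → ℤ, c ≠ 0 ∧
            (fun i => (c i : ℝ)) ∈
              normalCone (A.map (Int.cast : ℤ → ℝ)) (fun i => (b i : ℝ)) v ∧
            (fun i => -(c i : ℝ)) ∈
              normalCone (A.map (Int.cast : ℤ → ℝ)) (fun i => (b i : ℝ)) u ∧
            w = ∑ i, (c i : ℝ) * (v i - u i)} := by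
  obtain ⟨w, hw, hPw⟩ := hsimplex
  set A' : Matrix (Fin (n + 1)) (Fin n) ℝ := A.map (Int.cast : ℤ → ℝ)
  set b' : Fin (n + 1) → ℝ := fun i => (b i : ℝ)
  have hP' : P = {x | ∀ i, (A' *ᵥ x) i ≤ b' i} := hP
  have hcompact : IsCompact P := hPw ▸ (Set.finite_range w).isCompact_convexHull ℝ
  have hnonempty : P.Nonempty := by
    rw [hPw, convexHull_nonempty_iff (𝕜 := ℝ)]
    exact Set.range_nonempty w
  have hspan : affineSpan ℝ P = ⊤ := by
    rw [hPw, affineSpan_convexHull, hw.affineSpan_eq_top_iff_card_eq_finrank_add_one]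
    simp
  have hwidth : ∀ (c : Fin n → ℝ) (v u : Fin n → ℝ), v ∈ P → u ∈ P →
      (∀ x ∈ P, c ⬝ᵥ x ≤ c ⬝ᵥ v) → (∀ x ∈ P, c ⬝ᵥ u ≤ c ⬝ᵥ x) →
      sSup ((fun x : Fin n → ℝ => ∑ i, c i * x i) '' P)
        - sInf ((fun x : Fin n → ℝ => ∑ i, c i * x i) '' P) = ∑ i, c i * (v i - u i) := by
    intro c v u hv hu hmax hmin
    have h₁ : IsGreatest ((fun x : Fin n → ℝ => ∑ i, c i * x i) '' P) (c ⬝ᵥ v) :=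
      ⟨⟨v, hv, rfl⟩, Set.forall_mem_image.2 hmax⟩
    have h₂ : IsLeast ((fun x : Fin n → ℝ => ∑ i, c i * x i) '' P) (c ⬝ᵥ u) :=
      ⟨⟨u, hu, rfl⟩, Set.forall_mem_image.2 hmin⟩
    rw [h₁.csSup_eq, h₂.csInf_eq]
    exact (dotProduct_sub c v u).symm
  congr 1
  ext r
  constructor
  · rintro ⟨c, hc, rfl⟩
    set c' : Fin n → ℝ := fun i => (c i : ℝ)
    obtain ⟨v, hv, hmax⟩ := exists_extremePoint_forall_dotProduct_le hcompact hnonempty c'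
    obtain ⟨u, hu, hmin⟩ := exists_extremePoint_forall_dotProduct_le hcompact hnonempty (-c')
    have hmin' : ∀ x ∈ P, c' ⬝ᵥ u ≤ c' ⬝ᵥ x := by simpa [neg_dotProduct] using hmin
    have hne : v ≠ u := by
      rintro rfl
      have h := eq_zero_of_forall_dotProduct_eq hspan
        fun x hx => le_antisymm (hmax x hx) (hmin' x hx)
      exact hc (funext fun i => by simpa [c'] using congrFun h i)
    refine ⟨v, hv, u, hu, hne, c, hc, ?_, ?_, hwidth c' v u hv.1 hu.1 hmax hmin'⟩
    · rw [hP'] at hcompact hv hu hmax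
      exact mem_normalCone_of_forall_dotProduct_le hcompact.isBounded hv hu.1 hne hmax
    · rw [hP'] at hcompact hv hu hmin
      exact mem_normalCone_of_forall_dotProduct_le hcompact.isBounded hu hv.1 hne.symm hmin
  · rintro ⟨v, hv, u, hu, -, c, hc, hcv, hcu, rfl⟩
    refine ⟨c, hc, (hwidth (fun i => (c i : ℝ)) v u hv.1 hu.1 (fun x hx => ?_) fun x hx => ?_).symm⟩
    · rw [hP'] at hx
      exact dotProduct_le_of_mem_normalCone hcv hx
    · rw [hP'] at hx
      have h : -(fun i => (c i : ℝ)) ⬝ᵥ x ≤ -(fun i => (c i : ℝ)) ⬝ᵥ u :=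
        dotProduct_le_of_mem_normalCone hcu hx
      simpa only [neg_dotProduct, neg_le_neg_iff] using h
end

section
/- Let $B \in \mathbb{R}^{n \times (n-1)}$, $a_v, a_u \in \mathbb{R}^n$, and $v, u \in \mathbb{R}^n$ with $B^\top (v-u) = 0$, $a_v^\top (v-u) > 0$ and $a_u^\top (v-u) < 0$. Let $C_v = \mathrm{cone}([B \mid a_v])$ and $C_u = \mathrm{cone}([B \mid a_u])$ be the cones spanned by the columns of $B$ together with $a_v$ (resp. $a_u$). For $k \in \mathbb{R}_+$ let $H(k) = \{x \in \mathbb{R}^n : (v-u)^\top x = k\}$, let $p_v(k) = \frac{k}{a_v^\top(v-u)}\, a_v$ and $p_u(k) = \frac{k}{-a_u^\top(v-u)}\,(-a_u)$. Then $C_v \cap (-C_u) \cap H(k) = (p_v(k) + \mathrm{cone}(B)) \cap (p_u(k) - \mathrm{cone}(B))$. -/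
open scoped BigOperators

/-- The cone spanned by the columns of `B` together with an extra column `a`. -/
def coneAug {m n : ℕ} (B : Matrix (Fin m) (Fin n) ℝ) (a : Fin m → ℝ) :
    Set (Fin m → ℝ) :=
  {x | ∃ (t : Fin n → ℝ) (s : ℝ), (∀ j, 0 ≤ t j) ∧ 0 ≤ s ∧ x = B.mulVec t + s • a}

open Matrix in
/-- A hyperplane whose normal `w` is orthogonal to the columns of `B` but not to `a` cuts
`cone([B|a])` in a translate of `cone(B)`. -/
theorem mem_coneAug_and_dotProduct_eq_iff {m n : ℕ} {B : Matrix (Fin m) (Fin n) ℝ}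
    {a w : Fin m → ℝ} (hB : w ᵥ* B = 0) (ha : w ⬝ᵥ a ≠ 0) {k : ℝ} (hk : 0 ≤ k / (w ⬝ᵥ a))
    (x : Fin m → ℝ) :
    x ∈ coneAug B a ∧ w ⬝ᵥ x = k ↔ ∃ c ∈ coneOf B, x = (k / (w ⬝ᵥ a)) • a + c := by
  have dot (t : Fin n → ℝ) (s : ℝ) : w ⬝ᵥ (B *ᵥ t + s • a) = s * (w ⬝ᵥ a) := by
    rw [dotProduct_add, dotProduct_mulVec, hB, zero_dotProduct, zero_add, dotProduct_smul,
      smul_eq_mul]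
  constructor
  · rintro ⟨⟨t, s, ht, -, rfl⟩, rfl⟩
    refine ⟨B *ᵥ t, ⟨t, ht, rfl⟩, ?_⟩
    rw [dot, mul_div_cancel_right₀ _ ha, add_comm]
  · rintro ⟨_, ⟨t, ht, rfl⟩, rfl⟩
    rw [add_comm]
    exact ⟨⟨t, _, ht, hk, rfl⟩, by rw [dot, div_mul_cancel₀ _ ha]⟩

/-- Intersecting the cone `cone([B|a_v]) ∩ (-cone([B|a_u]))` with the hyperplane
`H(k) = {x : (v-u)ᵀ x = k}` yields `(p_v(k) + cone(B)) ∩ (p_u(k) - cone(B))`. -/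
theorem cone_inter_hyperplane_eq
    (n : ℕ) (B : Matrix (Fin n) (Fin (n - 1)) ℝ) (av au v u : Fin n → ℝ)
    (hB : ∀ j, (∑ i, B i j * (v i - u i)) = 0)
    (hav : 0 < ∑ i, av i * (v i - u i))
    (hau : (∑ i, au i * (v i - u i)) < 0)
    (k : ℝ) (hk : 0 ≤ k)
    (pv pu : Fin n → ℝ)
    (hpv : pv = (k / ∑ i, av i * (v i - u i)) • av)
    (hpu : pu = (k / -(∑ i, au i * (v i - u i))) • (-au)) :
    coneAug B av ∩ {x | -x ∈ coneAug B au} ∩ {x | (∑ i, (v i - u i) * x i) = k}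
      = {x | ∃ c ∈ coneOf B, x = pv + c} ∩ {x | ∃ c ∈ coneOf B, x = pu - c} := by
  have comm (a : Fin n → ℝ) : ∑ i, a i * (v i - u i) = (v - u) ⬝ᵥ a :=
    dotProduct_comm a (v - u)
  have hB' : Matrix.vecMul (v - u) B = 0 := funext fun j => (comm fun i => B i j).symm.trans (hB j)
  rw [comm] at hav hau hpv hpu
  have hv := mem_coneAug_and_dotProduct_eq_iff hB' hav.ne' (div_nonneg hk hav.le)
  have hu := mem_coneAug_and_dotProduct_eq_iff hB' hau.ne
    (div_nonneg_of_nonpos (neg_nonpos.mpr hk) hau.le)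
  rw [← hpv] at hv
  have hpu' : (-k / ((v - u) ⬝ᵥ au)) • au = -pu := by
    rw [hpu, div_neg, smul_neg, neg_smul, neg_neg, neg_div, neg_smul]
  rw [hpu'] at hu
  ext x
  have hxu : (∃ c ∈ coneOf B, -x = -pu + c) ↔ ∃ c ∈ coneOf B, x = pu - c := by
    simp only [neg_eq_iff_eq_neg, neg_add, neg_neg, sub_eq_add_neg]
  change (x ∈ coneAug B av ∧ -x ∈ coneAug B au) ∧ (v - u) ⬝ᵥ x = k ↔
    (∃ c ∈ coneOf B, x = pv + c) ∧ ∃ c ∈ coneOf B, x = pu - c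
  rw [← hv, ← hxu, ← hu, dotProduct_neg, neg_inj]
  tauto
end
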